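/- For every dimension d ≥ 1, every nonempty subset u ⊆ {1,…,d}, and every integer N ≥ 2, the star discrepancy of the projection onto the coordinates in u of the first N points of the d-dimensional Halton sequence satisfies D*_N(H_{d,N}(u)) ≤ ((log N)^{|u|}/N) · ∏_{j∈u} 6j. -/

import Mathlib

open Finset Real

noncomputable section

/-- Radical inverse function in base `b`: if `n = ∑ nᵢ bⁱ` then `radInv b n = ∑ nᵢ b^{-i-1}`. -/
def radInv (b n : ℕ) : ℝ := ∑' i : ℕ, (((n / b ^ i) % b : ℕ) : ℝ) / (b : ℝ) ^ (i + 1)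

/-- `n`-th point of the `d`-dimensional Halton sequence; coordinate `j` (0-based)
uses the `(j+1)`-st prime (`Nat.nth Nat.Prime 0 = 2`). -/
def halton (d n : ℕ) : Fin d → ℝ := fun j => radInv (Nat.nth Nat.Prime j) n

open scoped Classical in
/-- Star discrepancy of the point set `P` of `N` points with coordinates indexed by `ι`:
`D*_N(P) = sup_{α ∈ [0,1]^ι} |#{n : P n ∈ [0,α)}/N − ∏ᵢ αᵢ|`. -/
def starDisc {ι : Type} [Fintype ι] (N : ℕ) (P : Fin N → ι → ℝ) : ℝ :=
  sSup {t : ℝ | ∃ α : ι → ℝ, (∀ i, 0 ≤ α i ∧ α i ≤ 1) ∧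
    t = |((Finset.univ.filter fun n : Fin N => ∀ i, 0 ≤ P n i ∧ P n i < α i).card : ℝ) / N
          - ∏ i, α i|}

/-- Star discrepancy of the projection of the first `N` points of the `d`-dimensional
Halton sequence onto the coordinates in `u`. -/
def haltonProjStarDisc (d N : ℕ) (u : Finset (Fin d)) : ℝ :=
  starDisc N fun n (i : u) => halton d n i.1

/-- Weighted star discrepancy, for product weights built from `γ : ℕ → ℝ` (1-based:
coordinate `j : Fin d` carries weight `γ (j+1)`), of the first `N` points of the
`d`-dimensional Halton sequence:
`max_{∅ ≠ u ⊆ [d]} (∏_{j ∈ u} γ_j) · D*_N(H_{d,N}(u))`. -/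
def wHaltonStarDisc (γ : ℕ → ℝ) (d N : ℕ) : ℝ :=
  sSup {t : ℝ | ∃ u : Finset (Fin d), u.Nonempty ∧
    t = (∏ j ∈ u, γ (j.1 + 1)) * haltonProjStarDisc d N u}

/-- A set of naturals `A` of prescribed mass `c` that is either a residue class modulo `b ^ l`
with mass `b ^ (-l)`, or a subset of a residue class modulo `b ^ m` with mass at most
`b ^ (-m)`. -/
def IsRadicalCell (b m : ℕ) (A : Set ℕ) (c : ℝ) : Prop :=
  ∃ r l : ℕ, (∀ n ∈ A, n ≡ r [MOD b ^ l]) ∧ 0 ≤ c ∧ c * (b : ℝ) ^ l ≤ 1 ∧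
    (l = m ∨ (∀ n, n ≡ r [MOD b ^ l] → n ∈ A) ∧ c * (b : ℝ) ^ l = 1)

theorem radInv_eq_mod_add_div {b : ℕ} (hb : 2 ≤ b) (n : ℕ) :
    radInv b n = ((n % b : ℕ) + radInv b (n / b)) / b := by
  have hb0 : (b : ℝ) ≠ 0 := by positivity
  have hs : Summable fun i : ℕ => (((n / b ^ i) % b : ℕ) : ℝ) / (b : ℝ) ^ (i + 1) := by
    refine summable_of_hasFiniteSupport (Set.Finite.subset (Set.finite_lt_nat n) ?_)
    intro i hi
    by_contra h
    have hlt : n < b ^ i := (not_lt.mp h).trans_lt (Nat.lt_pow_self (by omega))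
    simp [Nat.div_eq_of_lt hlt] at hi
  rw [radInv, hs.tsum_eq_zero_add, radInv, add_div, ← tsum_div_const]
  congr 1
  · simp
  · refine tsum_congr fun i => ?_
    rw [Nat.div_div_eq_div_mul, ← pow_succ' b i, pow_succ _ (i + 1), div_div]

theorem radInv_nonneg (b n : ℕ) : 0 ≤ radInv b n :=
  tsum_nonneg fun _ => by positivity

theorem radInv_lt_one {b : ℕ} (hb : 2 ≤ b) (n : ℕ) : radInv b n < 1 := by
  induction n using Nat.strong_induction_on with
  | _ n ih =>
    rcases Nat.eq_zero_or_pos n with rfl | hn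
    · simp [radInv]
    · have h := ih (n / b) (Nat.div_lt_self hn hb)
      have hm : ((n % b : ℕ) : ℝ) + 1 ≤ b := by
        exact_mod_cast Nat.mod_lt n (by omega)
      rw [radInv_eq_mod_add_div hb, div_lt_one (by positivity)]
      linarith

theorem isRadicalCell_mod_eq {b : ℕ} (m : ℕ) {i : ℕ} (hi : i < b) :
    IsRadicalCell b m {n | n % b = i} (1 / b) := by
  have hb0 : (b : ℝ) ≠ 0 := by
    have : b ≠ 0 := by omega
    exact_mod_cast this
  refine ⟨i, 1, fun n hn => ?_, by positivity, by simp [hb0], Or.inr ⟨fun n hn => ?_, by simp [hb0]⟩⟩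
  · simpa [Nat.ModEq, Nat.mod_eq_of_lt hi] using hn
  · simpa [Nat.ModEq, Nat.mod_eq_of_lt hi] using hn

theorem IsRadicalCell.shift {b m a : ℕ} (ha : a < b) {A : Set ℕ} {c : ℝ}
    (h : IsRadicalCell b m A c) :
    IsRadicalCell b (m + 1) {n | n % b = a ∧ n / b ∈ A} (c / b) := by
  have hb : b ≠ 0 := by omega
  have hb0 : (b : ℝ) ≠ 0 := by exact_mod_cast hb
  obtain ⟨r, l, hA, hc, hcl, hml⟩ := h
  have hmass : c / b * (b : ℝ) ^ (l + 1) = c * (b : ℝ) ^ l := by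
    rw [pow_succ']
    field_simp
  refine ⟨a + b * r, l + 1, ?_, by positivity, hmass.trans_le hcl, ?_⟩
  · rintro n ⟨hna, hnA⟩
    rw [← Nat.mod_add_div n b, hna, pow_succ']
    exact ((hA _ hnA).mul_left' b).add_left a
  · refine hml.imp (by rintro rfl; rfl) ?_
    rintro ⟨hA', hc'⟩
    refine ⟨fun n hn => ?_, hmass.trans hc'⟩
    have hna : n % b = a := by
      have := hn.of_dvd (dvd_pow_self b (Nat.succ_ne_zero l))
      simpa [Nat.ModEq, Nat.mod_eq_of_lt ha] using this
    refine ⟨hna, hA' _ ?_⟩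
    rw [← Nat.mod_add_div n b, hna, pow_succ'] at hn
    exact Nat.ModEq.mul_left_cancel' hb (Nat.ModEq.add_left_cancel' a hn)

/-- The indices whose radical inverse is below `α` split into at most `(b - 1) m + 1` cells of
total mass `α`. -/
theorem exists_radicalCell_decomposition {b : ℕ} (hb : 2 ≤ b) (m : ℕ) {α : ℝ} (h0 : 0 ≤ α)
    (h1 : α ≤ 1) :
    ∃ (κ : Type) (_ : Fintype κ) (A : κ → Set ℕ) (c : κ → ℝ),
      Fintype.card κ ≤ (b - 1) * m + 1 ∧ (∀ k, IsRadicalCell b m (A k) (c k)) ∧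
      (∀ n, Set.indicator {n | radInv b n < α} (fun _ => (1 : ℝ)) n =
        ∑ k, Set.indicator (A k) (fun _ => (1 : ℝ)) n) ∧ ∑ k, c k = α := by
  induction m generalizing α with
  | zero =>
    exact ⟨Unit, inferInstance, fun _ => {n | radInv b n < α}, fun _ => α, by simp,
      fun _ => ⟨0, 0, by simp [Nat.modEq_one], h0, by simpa using h1, Or.inl rfl⟩, by simp, by simp⟩
  | succ m ih =>
    have hb0 : (0 : ℝ) < b := by positivity
    obtain ⟨a, hab, hβ0, hβ1⟩ : ∃ a : ℕ, a < b ∧ 0 ≤ b * α - a ∧ b * α - a ≤ 1 := by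
      rcases lt_or_ge ⌊b * α⌋₊ b with h | h
      · have := Nat.floor_le (mul_nonneg hb0.le h0)
        have := (Nat.lt_floor_add_one (b * α)).le
        exact ⟨⌊b * α⌋₊, h, by linarith, by linarith⟩
      · have hle : (b : ℝ) ≤ b * α := (Nat.le_floor_iff (by positivity)).mp h
        refine ⟨b - 1, by omega, ?_, ?_⟩ <;> push_cast [Nat.cast_sub (show 1 ≤ b by omega)] <;>
          nlinarith
    obtain ⟨κ, _, A, c, hcard, hcell, hind, hsum⟩ := ih hβ0 hβ1
    refine ⟨Fin a ⊕ κ, inferInstance,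
      Sum.elim (fun i => {n | n % b = i}) (fun k => {n | n % b = a ∧ n / b ∈ A k}),
      Sum.elim (fun _ => 1 / b) (fun k => c k / b), ?_, ?_, ?_, ?_⟩
    · simp only [Fintype.card_sum, Fintype.card_fin]
      have : a ≤ b - 1 := by omega
      rw [mul_add]
      omega
    · rintro (i | k)
      · exact isRadicalCell_mod_eq _ (i.2.trans hab)
      · exact (hcell k).shift hab
    · intro n
      classical
      have hind' := hind (n / b)
      have hx0 := radInv_nonneg b (n / b)
      have hx1 := radInv_lt_one hb (n / b)
      have hiff : radInv b n < α ↔ ((n % b : ℕ) : ℝ) + radInv b (n / b) < b * α := by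
        rw [radInv_eq_mod_add_div hb, div_lt_iff₀' hb0]
      have hfin : ∑ i : Fin a, Set.indicator {n | n % b = i} (fun _ => (1 : ℝ)) n =
          if n % b < a then 1 else 0 := by
        simp only [Set.indicator_apply, Set.mem_ofPred_eq]
        rw [Fin.sum_univ_eq_sum_range (fun i => if n % b = i then (1 : ℝ) else 0)]
        simp
      rw [Fintype.sum_sum_type]
      simp only [Sum.elim_inl, Sum.elim_inr]
      rw [hfin]
      simp only [Set.indicator_apply, Set.mem_ofPred_eq, hiff] at hind' ⊢
      rcases lt_trichotomy (n % b) a with h | h | h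
      · have : ((n % b : ℕ) : ℝ) + 1 ≤ a := by exact_mod_cast h
        rw [if_pos (by linarith), if_pos h]
        simp [h.ne]
      · simp only [h, ← lt_sub_iff_add_lt', hind', lt_irrefl, if_false, zero_add, true_and]
      · have : (a : ℝ) + 1 ≤ (n % b : ℕ) := by exact_mod_cast h
        rw [if_neg (by linarith), if_neg h.not_gt]
        simp [h.ne']
    · simp only [Fintype.sum_sum_type, Sum.elim_inl, Sum.elim_inr, Finset.sum_const,
        Finset.card_univ, Fintype.card_fin, nsmul_eq_mul, ← Finset.sum_div, hsum]
      field_simp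
      ring

theorem abs_count_modEq_sub_le_one (N v : ℕ) {q : ℕ} (hq : 0 < q) :
    |(N.count (· ≡ v [MOD q]) : ℝ) - N / q| ≤ 1 := by
  have hq' : (0 : ℝ) < q := by exact_mod_cast hq
  rw [Nat.count_modEq_card _ hq]
  have hN : (N : ℝ) / q = (N / q : ℕ) + ((N % q : ℕ) : ℝ) / q := by
    field_simp
    exact_mod_cast (Nat.div_add_mod N q).symm
  have h0 : (0 : ℝ) ≤ ((N % q : ℕ) : ℝ) / q := by positivity
  have h1 : ((N % q : ℕ) : ℝ) / q ≤ 1 := by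
    rw [div_le_one hq']
    exact_mod_cast (Nat.mod_lt N hq).le
  rw [hN, abs_le]
  split_ifs <;> push_cast <;> constructor <;> linarith

theorem prod_indicator_one_eq_indicator {ι : Type} [Fintype ι] (A : ι → Set ℕ) (n : ℕ) :
    ∏ i, Set.indicator (A i) (fun _ => (1 : ℝ)) n =
      Set.indicator {n | ∀ i, n ∈ A i} (fun _ => (1 : ℝ)) n := by
  classical
  simp only [Set.indicator_apply, Set.mem_ofPred_eq]
  by_cases h : ∀ i, n ∈ A i
  · simp [h]
  · obtain ⟨i, hi⟩ := not_forall.mp h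
    rw [if_neg h]
    exact Finset.prod_eq_zero (Finset.mem_univ i) (if_neg hi)

/-- The local discrepancy of the first `N` naturals on a product of cells is at most `1`. -/
theorem abs_sum_prod_radicalCell_sub_le_one {ι : Type} [Fintype ι] {b m : ι → ℕ}
    (hb : ∀ i, 2 ≤ b i) (hcop : Pairwise fun i j => (b i).Coprime (b j)) {N : ℕ}
    (hN : ∀ i, N ≤ b i ^ m i) {A : ι → Set ℕ} {c : ι → ℝ}
    (h : ∀ i, IsRadicalCell (b i) (m i) (A i) (c i)) :
    |∑ n ∈ Finset.range N, ∏ i, Set.indicator (A i) (fun _ => (1 : ℝ)) n - N * ∏ i, c i| ≤ 1 := by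
  classical
  choose r l hA hc hcl hml using h
  have hpow (i : ι) : (1 : ℝ) ≤ (b i : ℝ) ^ l i :=
    one_le_pow₀ (by exact_mod_cast (hb i).trans' one_le_two)
  have hc1 (i : ι) : c i ≤ 1 :=
    (le_mul_of_one_le_right (hc i) (hpow i)).trans (hcl i)
  simp only [prod_indicator_one_eq_indicator]
  rw [Finset.sum_indicator_eq_sum_filter, Finset.sum_const, nsmul_one]
  by_cases hex : ∃ i, l i = m i
  · obtain ⟨i, hi⟩ := hex
    have hcard : (((Finset.range N).filter fun n => n ∈ {n | ∀ i, n ∈ A i}).card : ℝ) ≤ 1 := by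
      have : ((Finset.range N).filter fun n => n ∈ {n | ∀ i, n ∈ A i}).card ≤ 1 := by
        refine Finset.card_le_one.mpr fun x hx y hy => ?_
        simp only [Finset.mem_filter, Finset.mem_range, Set.mem_ofPred_eq] at hx hy
        have hNl : N ≤ b i ^ l i := hi ▸ hN i
        exact Nat.ModEq.eq_of_lt_of_lt ((hA i x (hx.2 i)).trans (hA i y (hy.2 i)).symm)
          (hx.1.trans_le hNl) (hy.1.trans_le hNl)
      exact_mod_cast this
    have hprod0 : 0 ≤ ∏ i, c i := Finset.prod_nonneg fun i _ => hc i
    have hprod : N * ∏ j, c j ≤ 1 := by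
      have hle : ∏ j, c j ≤ c i := by
        rw [← Finset.mul_prod_erase _ _ (Finset.mem_univ i)]
        exact mul_le_of_le_one_right (hc i)
          (Finset.prod_le_one (fun j _ => hc j) fun j _ => hc1 j)
      have hNl : (N : ℝ) ≤ (b i : ℝ) ^ l i := by
        rw [hi]
        exact_mod_cast hN i
      calc N * ∏ j, c j ≤ (b i : ℝ) ^ l i * c i := by gcongr
        _ ≤ 1 := by rw [mul_comm]; exact hcl i
    have := mul_nonneg (Nat.cast_nonneg (α := ℝ) N) hprod0
    have := Nat.cast_nonneg (α := ℝ) ((Finset.range N).filter fun n => n ∈ {n | ∀ i, n ∈ A i}).card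
    rw [abs_le]
    constructor <;> linarith
  · push Not at hex
    have hml' (i : ι) := (hml i).resolve_left (hex i)
    have hpos : ∀ i ∈ Finset.univ, b i ^ l i ≠ 0 := fun i _ =>
      pow_ne_zero _ (by have := hb i; omega)
    have hpair : Set.Pairwise (↑(Finset.univ : Finset ι))
        (Function.onFun Nat.Coprime fun i => b i ^ l i) :=
      fun i _ j _ hij => Nat.Coprime.pow _ _ (hcop hij)
    let v := Nat.chineseRemainderOfFinset r (fun i => b i ^ l i) Finset.univ hpos hpair
    have hmem (n : ℕ) : n ∈ {n | ∀ i, n ∈ A i} ↔ n ≡ v [MOD ∏ i, b i ^ l i] := by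
      constructor
      · intro hn
        refine (Nat.modEq_iff_dvd).mpr ?_
        push_cast
        refine Finset.prod_dvd_of_coprime (fun i _ j _ hij => ?_) fun i _ => ?_
        · simpa using Nat.isCoprime_iff_coprime.mpr (Nat.Coprime.pow (l i) (l j) (hcop hij))
        · exact_mod_cast Nat.modEq_iff_dvd.mp
            ((hA i n (hn i)).trans (v.2 i (Finset.mem_univ i)).symm)
      · intro hn i
        exact (hml' i).1 n ((hn.of_dvd (Finset.dvd_prod_of_mem _ (Finset.mem_univ i))).trans
          (v.2 i (Finset.mem_univ i)))
    have hprod : ∏ i, c i = 1 / ((∏ i, b i ^ l i : ℕ) : ℝ) := by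
      push_cast
      rw [one_div, ← Finset.prod_inv_distrib]
      exact Finset.prod_congr rfl fun i _ => eq_inv_of_mul_eq_one_left (hml' i).2
    have hcount := abs_count_modEq_sub_le_one N v
      (Nat.pos_of_ne_zero (Finset.prod_ne_zero_iff.mpr hpos))
    rw [Nat.count_eq_card_filter_range] at hcount
    rw [hprod, mul_one_div]
    simpa only [hmem] using hcount

/-- Counting error of the first `N` points of the Halton sequence in coprime bases `b i`. -/
theorem abs_card_radInv_lt_sub_le {ι : Type} [Fintype ι] {b : ι → ℕ}
    (hb : ∀ i, 2 ≤ b i) (hcop : Pairwise fun i j => (b i).Coprime (b j)) {N : ℕ} {m : ι → ℕ}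
    (hN : ∀ i, N ≤ b i ^ m i) {α : ι → ℝ} (hα : ∀ i, 0 ≤ α i ∧ α i ≤ 1) :
    |∑ n ∈ Finset.range N, Set.indicator {n | ∀ i, radInv (b i) n < α i} (fun _ => (1 : ℝ)) n
        - N * ∏ i, α i| ≤ ∏ i, (((b i - 1) * m i + 1 : ℕ) : ℝ) := by
  classical
  choose κ hκ A c hcard hcell hind hsum using fun i =>
    exists_radicalCell_decomposition (hb i) (m i) (hα i).1 (hα i).2
  have hprod (n : ℕ) : Set.indicator {n | ∀ i, radInv (b i) n < α i} (fun _ => (1 : ℝ)) n =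
      ∑ k : ∀ i, κ i, ∏ i, Set.indicator (A i (k i)) (fun _ => (1 : ℝ)) n := by
    rw [← Fintype.prod_sum fun i k => Set.indicator (A i k) (fun _ => (1 : ℝ)) n]
    simp only [← hind]
    rw [prod_indicator_one_eq_indicator]
    rfl
  have hα' : ∏ i, α i = ∑ k : ∀ i, κ i, ∏ i, c i (k i) := by
    rw [← Fintype.prod_sum]
    simp only [hsum]
  simp only [hprod]
  rw [Finset.sum_comm, hα', Finset.mul_sum, ← Finset.sum_sub_distrib]
  calc _ ≤ ∑ k : ∀ i, κ i, (1 : ℝ) :=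
        (Finset.abs_sum_le_sum_abs _ _).trans <| Finset.sum_le_sum fun k _ =>
          abs_sum_prod_radicalCell_sub_le_one hb hcop hN fun i => hcell i (k i)
    _ = ∏ i, (Fintype.card (κ i) : ℝ) := by simp
    _ ≤ _ := Finset.prod_le_prod (fun _ _ => by positivity) fun i _ => by exact_mod_cast hcard i

theorem le_three_mul_primeCounting_mul_log {n : ℕ} (hn : 2 ≤ n) :
    (n : ℝ) ≤ 3 * (Nat.primeCounting n * Real.log n) := by
  have hlog2 := Real.log_two_gt_d9
  rcases lt_or_ge n 6 with h | h
  · have hπ : n ≤ 2 * Nat.primeCounting n := by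
      interval_cases n <;> decide
    have hπ' : (n : ℝ) ≤ 2 * Nat.primeCounting n := by exact_mod_cast hπ
    have hlog : Real.log 2 ≤ Real.log n := Real.log_le_log (by norm_num) (by exact_mod_cast hn)
    nlinarith [Nat.cast_nonneg (α := ℝ) (Nat.primeCounting n)]
  · have hψ := (Chebyshev.psi_ge n).trans (Chebyshev.psi_le_primeCounting_mul_log n)
    have hn' : (6 : ℝ) ≤ n := by exact_mod_cast h
    have hlog8 : Real.log 8 = 3 * Real.log 2 := by
      rw [show (8 : ℝ) = 2 ^ 3 by norm_num, Real.log_pow]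
      norm_num
    have hlog : Real.log (n + 1) ≤ (n + 1) / 8 - 1 + Real.log 8 := by
      have := Real.log_le_sub_one_of_pos (show (0 : ℝ) < (n + 1) / 8 by positivity)
      rw [Real.log_div (by positivity) (by norm_num)] at this
      linarith
    have hlog2' := Real.log_two_lt_d9
    nlinarith

theorem nth_prime_le_three_mul (j : ℕ) :
    (Nat.nth Nat.Prime j : ℝ) ≤ 3 * ((j + 1 : ℕ) * Real.log (Nat.nth Nat.Prime j)) := by
  have hp := Nat.prime_nth_prime j
  have h := le_three_mul_primeCounting_mul_log hp.two_le
  have hπ : Nat.primeCounting (Nat.nth Nat.Prime j) = j + 1 := by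
    rw [Nat.primeCounting, Nat.primeCounting', Nat.count_nth_succ_of_infinite
      Nat.infinite_setOfPred_prime]
  rwa [hπ] at h

theorem le_three_mul_of_lt_nth_prime {j N : ℕ} (hN : 2 ≤ N) (h : N < Nat.nth Nat.Prime j) :
    (N : ℝ) ≤ 3 * (j * Real.log N) := by
  have hπ : Nat.primeCounting N ≤ j := by
    rw [← Nat.primeCounting'_nth_eq j, Nat.primeCounting]
    exact Nat.monotone_primeCounting' h
  have hlog : 0 ≤ Real.log N := Real.log_natCast_nonneg N
  refine (le_three_mul_primeCounting_mul_log hN).trans ?_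
  gcongr

theorem digit_cell_count_le {j N : ℕ} (hN : Nat.nth Nat.Prime j ≤ N) :
    (((Nat.nth Nat.Prime j - 1) * (Nat.log (Nat.nth Nat.Prime j) N + 1) + 1 : ℕ) : ℝ) ≤
      Real.log N * (6 * ((j + 1 : ℕ) : ℝ)) := by
  have hp3 := nth_prime_le_three_mul j
  have hp := (Nat.prime_nth_prime j).two_le
  set p := Nat.nth Nat.Prime j
  have hp' : (2 : ℝ) ≤ p := by exact_mod_cast hp
  have hlogp : 0 < Real.log p := Real.log_pos (by linarith)
  have hlogN : Real.log p ≤ Real.log N :=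
    Real.log_le_log (by linarith) (by exact_mod_cast hN)
  have hfloor : (Nat.log p N : ℝ) * Real.log p ≤ Real.log N := by
    rw [← Real.log_pow]
    exact Real.log_le_log (by positivity) (by exact_mod_cast Nat.pow_log_le_self p (by omega))
  have hcount : (p - 1) * (Nat.log p N + 1) + 1 ≤ p * (Nat.log p N + 1) := by
    obtain ⟨q, hq⟩ : ∃ q, p = q + 1 := ⟨p - 1, by omega⟩
    rw [hq]
    simp only [Nat.add_sub_cancel]
    nlinarith
  calc _ ≤ ((p * (Nat.log p N + 1) : ℕ) : ℝ) := by exact_mod_cast hcount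
    _ = p * ((Nat.log p N : ℝ) + 1) := by push_cast; ring
    _ ≤ 3 * ((j + 1 : ℕ) * Real.log p) * ((Nat.log p N : ℝ) + 1) := by gcongr
    _ = 3 * (j + 1 : ℕ) * (Nat.log p N * Real.log p + Real.log p) := by ring
    _ ≤ 3 * (j + 1 : ℕ) * (Real.log N + Real.log N) := by gcongr
    _ = _ := by ring

/-- Star discrepancy bound for projections of the Halton sequence:
`D*_N(H_{d,N}(u)) ≤ ((log N)^{|u|}/N) · ∏_{j∈u} 6j`. -/
theorem halton_proj_star_disc_bound :
    ∀ d : ℕ, 1 ≤ d → ∀ u : Finset (Fin d), u.Nonempty → ∀ N : ℕ, 2 ≤ N →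
      haltonProjStarDisc d N u ≤
        (Real.log N) ^ u.card / N * ∏ j ∈ u, (6 * ((j.1 + 1 : ℕ) : ℝ)) := by
  intro d _ u _ N hN
  have hN0 : (0 : ℝ) < N := by positivity
  have hlog2 := Real.log_two_gt_d9
  have hlog : Real.log 2 ≤ Real.log N := Real.log_le_log (by norm_num) (by exact_mod_cast hN)
  have hbound : (Real.log N) ^ u.card / N * ∏ j ∈ u, (6 * ((j.1 + 1 : ℕ) : ℝ)) =
      (∏ j : u, Real.log N * (6 * ((j.1.1 + 1 : ℕ) : ℝ))) / N := by
    rw [Finset.prod_coe_sort u fun j : Fin d => Real.log N * (6 * ((j.1 + 1 : ℕ) : ℝ)),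
      div_mul_eq_mul_div, ← Finset.prod_const, ← Finset.prod_mul_distrib]
  rw [hbound]
  refine Real.sSup_le ?_ (div_nonneg (Finset.prod_nonneg fun j _ => by positivity) hN0.le)
  rintro _ ⟨α, hα, rfl⟩
  rw [le_div_iff₀ hN0]
  by_cases hsmall : ∃ j : u, N < Nat.nth Nat.Prime j.1
  · obtain ⟨j, hj⟩ := hsmall
    have hone (i : u) : 1 ≤ Real.log N * (6 * ((i.1.1 + 1 : ℕ) : ℝ)) := by
      have : (1 : ℝ) ≤ ((i.1.1 + 1 : ℕ) : ℝ) := by exact_mod_cast Nat.succ_pos _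
      nlinarith
    have hjN : (N : ℝ) ≤ Real.log N * (6 * ((j.1.1 + 1 : ℕ) : ℝ)) := by
      have h3 := le_three_mul_of_lt_nth_prime hN hj
      have : (0 : ℝ) ≤ j.1.1 * Real.log N := by positivity
      push_cast
      nlinarith
    have hprod : (N : ℝ) ≤ ∏ j : u, Real.log N * (6 * ((j.1.1 + 1 : ℕ) : ℝ)) := by
      rw [← Finset.mul_prod_erase _ _ (Finset.mem_univ j)]
      exact hjN.trans (le_mul_of_one_le_right (hN0.le.trans hjN)
        (Finset.one_le_prod fun i _ => hone i))
    refine le_trans (mul_le_of_le_one_left hN0.le ?_) hprod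
    have hcard : (((Finset.univ.filter fun n : Fin N =>
        ∀ i : u, 0 ≤ halton d n i.1 ∧ halton d n i.1 < α i).card : ℕ) : ℝ) / N ≤ 1 := by
      rw [div_le_one hN0]
      exact_mod_cast (Finset.card_le_univ _).trans_eq (Fintype.card_fin N)
    have hvol0 : 0 ≤ ∏ i, α i := Finset.prod_nonneg fun i _ => (hα i).1
    have hvol1 : ∏ i, α i ≤ 1 := Finset.prod_le_one (fun i _ => (hα i).1) fun i _ => (hα i).2
    have hcard0 : (0 : ℝ) ≤ ((Finset.univ.filter fun n : Fin N =>
        ∀ i : u, 0 ≤ halton d n i.1 ∧ halton d n i.1 < α i).card : ℕ) / N := by positivity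
    exact abs_le.mpr ⟨by linarith, by linarith⟩
  · push Not at hsmall
    have hp (i : u) : (Nat.nth Nat.Prime i.1).Prime := Nat.prime_nth_prime _
    have hcop : Pairwise fun i j : u =>
        (Nat.nth Nat.Prime i.1).Coprime (Nat.nth Nat.Prime j.1) := fun i j hij =>
      (Nat.coprime_primes (hp i) (hp j)).mpr fun h =>
        hij (Subtype.ext (Fin.ext (Nat.nth_injective Nat.infinite_setOfPred_prime h)))
    have hcount := (abs_card_radInv_lt_sub_le (fun i => (hp i).two_le) hcop
      (fun i => (Nat.lt_pow_succ_log_self (hp i).one_lt N).le) hα).trans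
        (Finset.prod_le_prod (fun _ _ => by positivity) fun i _ => digit_cell_count_le (hsmall i))
    refine le_trans (le_of_eq ?_) hcount
    rw [← abs_of_pos hN0, ← abs_mul, sub_mul, abs_of_pos hN0, div_mul_cancel₀ _ hN0.ne',
      mul_comm (∏ i, α i), Finset.card_filter, Nat.cast_sum,
      ← Fin.sum_univ_eq_sum_range]
    congr 2
    refine Finset.sum_congr rfl fun n _ => ?_
    simp [Set.indicator_apply, halton, radInv_nonneg]
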